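/- Let Γ be a countable discrete amenable group with Følner net {Γ_i}_{i∈I}, and let P_i denote the orthogonal projection of ℓ²(Γ) onto the subspace of functions supported in Γ_i. Let 𝒩_Γ := {U_γ : γ ∈ Γ}'' be the group von Neumann algebra, i.e. the double commutant in B(ℓ²(Γ)) of the left regular representation unitaries (U_γ f)(x) = f(γ⁻¹x). Then {P_i}_{i∈I} is a Følner net for 𝒩_Γ: for every T ∈ 𝒩_Γ, lim_i ‖T P_i − P_i T‖₂ / ‖P_i‖₂ = 0. -/

import Mathlib

open Filter
open scoped Pointwise symmDiff

noncomputable def hsNorm {H : Type*} [NormedAddCommGroup H] [InnerProductSpace ℂ H]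
    {ι : Type*} (e : HilbertBasis ι ℂ H) (A : H →L[ℂ] H) : ℝ :=
  Real.sqrt (∑' i, ‖A (e i)‖ ^ 2)

open scoped ENNReal InnerProductSpace

theorem HilbertBasis.tsum_enorm_inner_sq {H : Type*} [NormedAddCommGroup H]
    [InnerProductSpace ℂ H] {ι : Type*} (b : HilbertBasis ι ℂ H) (v : H) :
    ∑' i, ‖⟪b i, v⟫_ℂ‖ₑ ^ 2 = ‖v‖ₑ ^ 2 := by
  have h : HasSum (fun i => ‖⟪b i, v⟫_ℂ‖ ^ 2) (‖v‖ ^ 2) := by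
    have := lp.hasSum_norm (p := 2) (by norm_num) (b.repr v)
    simpa [b.repr_apply_apply] using this
  have h2 := ENNReal.ofReal_tsum_of_nonneg (fun i => sq_nonneg (‖⟪b i, v⟫_ℂ‖)) h.summable
  rw [h.tsum_eq, ENNReal.ofReal_pow (norm_nonneg _), ofReal_norm] at h2
  rw [h2]
  exact tsum_congr fun i => by rw [ENNReal.ofReal_pow (norm_nonneg _), ofReal_norm]

theorem HilbertBasis.tsum_enorm_apply_sq {H : Type*} [NormedAddCommGroup H]
    [InnerProductSpace ℂ H] [CompleteSpace H] {ι κ : Type*} (e : HilbertBasis ι ℂ H)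
    (b : HilbertBasis κ ℂ H) (A : H →L[ℂ] H) :
    ∑' i, ‖A (e i)‖ₑ ^ 2 = ∑' x, ∑' y, ‖⟪b x, A (b y)⟫_ℂ‖ₑ ^ 2 := by
  have swap (u v : H) : ‖⟪u, A v⟫_ℂ‖ₑ = ‖⟪v, ContinuousLinearMap.adjoint A u⟫_ℂ‖ₑ := by
    rw [← ContinuousLinearMap.adjoint_inner_left, ← ofReal_norm, norm_inner_symm, ofReal_norm]
  simp_rw [← b.tsum_enorm_inner_sq (A _)]
  rw [ENNReal.tsum_comm]
  simp_rw [swap, HilbertBasis.tsum_enorm_inner_sq]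

theorem hsNorm_eq_sqrt_toReal {H : Type*} [NormedAddCommGroup H] [InnerProductSpace ℂ H]
    {ι : Type*} (e : HilbertBasis ι ℂ H) (A : H →L[ℂ] H) :
    hsNorm e A = √(∑' i, ‖A (e i)‖ₑ ^ 2).toReal := by
  rw [hsNorm, ENNReal.tsum_toReal_eq fun i => by simp]
  simp

/-- The standard orthonormal basis of `ℓ²(Γ)`. -/
noncomputable def lpStdBasis (Γ : Type*) : HilbertBasis Γ ℂ (lp (fun _ : Γ => ℂ) 2) :=
  HilbertBasis.ofRepr (LinearIsometryEquiv.refl ℂ _)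

theorem lpStdBasis_apply {Γ : Type*} [DecidableEq Γ] (x y : Γ) :
    lpStdBasis Γ x y = if y = x then 1 else 0 := by
  classical
  have : lpStdBasis Γ x = lp.single 2 x (1 : ℂ) := by
    rw [← (lpStdBasis Γ).repr_symm_single x]
    rfl
  rw [this, lp.single_apply]
  simp [Pi.single_apply]

theorem inner_lpStdBasis {Γ : Type*} (x : Γ) (f : lp (fun _ : Γ => ℂ) 2) :
    ⟪lpStdBasis Γ x, f⟫_ℂ = f x :=
  ((lpStdBasis Γ).repr_apply_apply f x).symm

theorem hsNorm_eq_sqrt_tsum_matrix {Γ ι : Type*} (e : HilbertBasis ι ℂ (lp (fun _ : Γ => ℂ) 2))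
    (A : lp (fun _ : Γ => ℂ) 2 →L[ℂ] lp (fun _ : Γ => ℂ) 2) :
    hsNorm e A = √(∑' x, ∑' y, ‖A (lpStdBasis Γ y) x‖ₑ ^ 2).toReal := by
  simp_rw [hsNorm_eq_sqrt_toReal, e.tsum_enorm_apply_sq (lpStdBasis Γ), inner_lpStdBasis]

/-- Composition with a permutation of `Γ`, as an operator on `ℓ²(Γ)`. -/
noncomputable def lpCompEquiv {Γ : Type*} (σ : Γ ≃ Γ) :
    lp (fun _ : Γ => ℂ) 2 →L[ℂ] lp (fun _ : Γ => ℂ) 2 :=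
  LinearMap.mkContinuous
    { toFun := fun f => ⟨fun x => f (σ x), memℓp_gen <|
        σ.summable_iff.2 ((lp.memℓp f).summable (by norm_num))⟩
      map_add' := fun _ _ => rfl
      map_smul' := fun _ _ => rfl } 1 fun f => by
    rw [one_mul]
    refine le_of_eq ?_
    rw [lp.norm_eq_tsum_rpow (by norm_num), lp.norm_eq_tsum_rpow (by norm_num)]
    congr 1
    exact σ.tsum_eq fun x => ‖f x‖ ^ (2 : ℝ≥0∞).toReal

theorem lpCompEquiv_apply {Γ : Type*} (σ : Γ ≃ Γ) (f : lp (fun _ : Γ => ℂ) 2) (x : Γ) :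
    lpCompEquiv σ f x = f (σ x) := rfl

/-- The matrix of an operator in the group von Neumann algebra is constant along the sets
`{(g * y, y)}`. -/
theorem apply_lpStdBasis_of_mem_bicommutant {Γ : Type*} [Group Γ]
    (U : Γ → (lp (fun _ : Γ => ℂ) 2 →L[ℂ] lp (fun _ : Γ => ℂ) 2))
    (hU : ∀ (γ₀ : Γ) (f : lp (fun _ : Γ => ℂ) 2) (x : Γ), (U γ₀ f) x = f (γ₀⁻¹ * x))
    {T : lp (fun _ : Γ => ℂ) 2 →L[ℂ] lp (fun _ : Γ => ℂ) 2}
    (hT : T ∈ Set.centralizer (Set.centralizer (Set.range U))) (x y : Γ) :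
    T (lpStdBasis Γ y) x = T (lpStdBasis Γ 1) (x * y⁻¹) := by
  classical
  set V := lpCompEquiv (Equiv.mulRight y⁻¹) with hV
  have hmem : V ∈ Set.centralizer (Set.range U) := by
    rintro _ ⟨γ, rfl⟩
    ext f z
    change U γ (V f) z = V (U γ f) z
    simp [hU, hV, lpCompEquiv_apply, mul_assoc]
  have hbasis : V (lpStdBasis Γ 1) = lpStdBasis Γ y := by
    ext z
    simp [hV, lpCompEquiv_apply, lpStdBasis_apply, mul_inv_eq_one]
  have hcomm : V (T (lpStdBasis Γ 1)) = T (V (lpStdBasis Γ 1)) :=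
    congrArg (fun A : _ →L[ℂ] _ => A (lpStdBasis Γ 1)) (hT V hmem)
  rw [← hbasis, ← hcomm]
  rfl

section Projection

variable {Γ : Type*} [DecidableEq Γ] {S : Finset Γ}
  {P : lp (fun _ : Γ => ℂ) 2 →L[ℂ] lp (fun _ : Γ => ℂ) 2}

theorem proj_lpStdBasis (hP : ∀ f x, (P f) x = if x ∈ S then f x else 0) (y : Γ) :
    P (lpStdBasis Γ y) = if y ∈ S then lpStdBasis Γ y else 0 := by
  ext x
  rw [hP]
  by_cases hxy : x = y
  · subst hxy
    split_ifs <;> simp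
  · split_ifs <;> simp [lpStdBasis_apply, hxy]

theorem hsNorm_proj {ι : Type*} (e : HilbertBasis ι ℂ (lp (fun _ : Γ => ℂ) 2))
    (hP : ∀ f x, (P f) x = if x ∈ S then f x else 0) :
    hsNorm e P = √(S.card : ℝ) := by
  have h (x : Γ) : ∑' y, ‖P (lpStdBasis Γ y) x‖ₑ ^ 2 = if x ∈ S then 1 else 0 := by
    rw [tsum_eq_single x fun y hy => by rw [hP, lpStdBasis_apply, if_neg hy.symm]; simp]
    rw [hP, lpStdBasis_apply, if_pos rfl]
    split_ifs <;> simp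
  rw [hsNorm_eq_sqrt_tsum_matrix]
  simp_rw [h]
  rw [tsum_eq_sum (s := S) fun x hx => if_neg hx]
  simp

theorem hsNorm_commutator_proj [Group Γ] {ι : Type*}
    (e : HilbertBasis ι ℂ (lp (fun _ : Γ => ℂ) 2))
    (hP : ∀ f x, (P f) x = if x ∈ S then f x else 0)
    {T : lp (fun _ : Γ => ℂ) 2 →L[ℂ] lp (fun _ : Γ => ℂ) 2}
    (hT : ∀ x y, T (lpStdBasis Γ y) x = T (lpStdBasis Γ 1) (x * y⁻¹)) :
    hsNorm e (T * P - P * T) =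
      √(∑' g, ‖T (lpStdBasis Γ 1) g‖ ^ 2 * (((g • S) ∆ S).card : ℝ)) := by
  have hentry (x g : Γ) : ‖(T * P - P * T) (lpStdBasis Γ (g⁻¹ * x)) x‖ₑ ^ 2 =
      if x ∈ (g • S) ∆ S then ‖T (lpStdBasis Γ 1) g‖ₑ ^ 2 else 0 := by
    change ‖T (P (lpStdBasis Γ (g⁻¹ * x))) x - P (T (lpStdBasis Γ (g⁻¹ * x))) x‖ₑ ^ 2 = _
    have hmem : x ∈ g • S ↔ g⁻¹ * x ∈ S := Finset.inv_smul_mem_iff.symm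
    rw [proj_lpStdBasis hP, hP]
    simp only [Finset.mem_symmDiff, hmem]
    have := hT x (g⁻¹ * x)
    rw [mul_inv_rev, inv_inv, mul_inv_cancel_left] at this
    by_cases h1 : g⁻¹ * x ∈ S <;> by_cases h2 : x ∈ S <;> simp [h1, h2, this]
  have hrow (x : Γ) : ∑' y, ‖(T * P - P * T) (lpStdBasis Γ y) x‖ₑ ^ 2 =
      ∑' g, if x ∈ (g • S) ∆ S then ‖T (lpStdBasis Γ 1) g‖ₑ ^ 2 else 0 := by
    rw [← ((Equiv.inv Γ).trans (Equiv.mulRight x)).tsum_eq]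
    exact tsum_congr fun g => hentry x g
  have hcol (g : Γ) : (∑' x, if x ∈ (g • S) ∆ S then ‖T (lpStdBasis Γ 1) g‖ₑ ^ 2 else 0) =
      ‖T (lpStdBasis Γ 1) g‖ₑ ^ 2 * (((g • S) ∆ S).card : ℝ≥0∞) := by
    rw [tsum_eq_sum (s := (g • S) ∆ S) fun x hx => if_neg hx,
      Finset.sum_congr rfl fun x hx => if_pos hx, Finset.sum_const, nsmul_eq_mul, mul_comm]
  rw [hsNorm_eq_sqrt_tsum_matrix]
  simp_rw [hrow]
  rw [ENNReal.tsum_comm]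
  simp_rw [hcol]
  rw [ENNReal.tsum_toReal_eq fun g => ENNReal.mul_ne_top (by simp) (by simp)]
  simp

end Projection

theorem stmt10 {Γ : Type*} [Group Γ] [Countable Γ] [DecidableEq Γ]
    {ι : Type*} (e : HilbertBasis ι ℂ (lp (fun _ : Γ => ℂ) 2))
    -- a Følner net for the amenable group `Γ`
    {I : Type*} [Preorder I] [IsDirected I (· ≤ ·)] [Nonempty I]
    (Γs : I → Finset Γ) (hne : ∀ i, (Γs i).Nonempty)
    (hFol : ∀ γ : Γ, Tendsto (fun i => ((((γ • Γs i) ∆ (Γs i)).card : ℝ) / ((Γs i).card : ℝ)))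
      atTop (nhds 0))
    -- the left regular representation `(U γ₀ f) x = f (γ₀⁻¹ x)`
    (U : Γ → (lp (fun _ : Γ => ℂ) 2 →L[ℂ] lp (fun _ : Γ => ℂ) 2))
    (hU : ∀ (γ₀ : Γ) (f : lp (fun _ : Γ => ℂ) 2) (x : Γ), (U γ₀ f) x = f (γ₀⁻¹ * x))
    -- `P i` is the orthogonal projection onto functions supported in `Γs i`
    (P : I → (lp (fun _ : Γ => ℂ) 2 →L[ℂ] lp (fun _ : Γ => ℂ) 2))
    (hP : ∀ (i : I) (f : lp (fun _ : Γ => ℂ) 2) (x : Γ),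
      (P i f) x = if x ∈ Γs i then f x else 0) :
    -- every `T` in the group von Neumann algebra `{U γ}''` satisfies the Følner condition
    ∀ T ∈ Set.centralizer (Set.centralizer (Set.range U)),
      Tendsto (fun i => hsNorm e (T * P i - P i * T) / hsNorm e (P i)) atTop (nhds 0) := by
  intro T hT
  have hratio (i : I) : hsNorm e (T * P i - P i * T) / hsNorm e (P i) =
      √(∑' g, ‖T (lpStdBasis Γ 1) g‖ ^ 2 *
        ((((g • Γs i) ∆ Γs i).card : ℝ) / ((Γs i).card : ℝ))) := by
    rw [hsNorm_commutator_proj e (hP i) (apply_lpStdBasis_of_mem_bicommutant U hU hT),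
      hsNorm_proj e (hP i), ← Real.sqrt_div' _ (Nat.cast_nonneg _), ← tsum_div_const]
    simp_rw [mul_div_assoc]
  simp_rw [hratio]
  have hsum : Summable fun g => ‖T (lpStdBasis Γ 1) g‖ ^ 2 := by
    simpa using (lp.memℓp (T (lpStdBasis Γ 1))).summable (by norm_num)
  have hbound (i : I) (g : Γ) :
      (((g • Γs i) ∆ Γs i).card : ℝ) / ((Γs i).card : ℝ) ≤ 2 := by
    rw [div_le_iff₀ (by exact_mod_cast (hne i).card_pos)]
    have h := (Finset.card_le_card (symmDiff_le_sup (a := g • Γs i) (b := Γs i))).trans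
      (Finset.card_union_le _ _)
    rw [Finset.card_smul_finset] at h
    exact_mod_cast h.trans_eq (two_mul _).symm
  have hlim := tendsto_tsum_of_dominated_convergence (𝓕 := (atTop : Filter I))
    (f := fun i g => ‖T (lpStdBasis Γ 1) g‖ ^ 2 *
      ((((g • Γs i) ∆ Γs i).card : ℝ) / ((Γs i).card : ℝ)))
    (hsum.mul_right 2) (fun g => (hFol g).const_mul _) (.of_forall fun i g => by
      rw [Real.norm_of_nonneg (by positivity)]
      exact mul_le_mul_of_nonneg_left (hbound i g) (by positivity))
  simpa using hlim.sqrt
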